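/- Assume p₁ ≠ p₂. Then for Lebesgue-almost every x ∈ [0,1], with digit sequence i₁, i₂, … of the P₃-representation of x, one has lim_{k→∞} ∏_{r=1}^{k} p_{θ(i_r)} / p_{i_r} = 0. -/

import Mathlib

open Filter MeasureTheory Finset

/-- The "beta" values `β₀ = 0`, `β₁ = p₀`, `β₂ = p₀ + p₁` associated with weights `p`. -/
noncomputable def P3beta (p : Fin 3 → ℝ) : Fin 3 → ℝ := ![0, p 0, p 0 + p 1]

/-- The P₃-value of a digit sequence `i : ℕ → Fin 3` (0-indexed):
`val(i) = β_{i₀} + Σ_{k≥1} β_{i_k} ∏_{r<k} p_{i_r}`. -/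
noncomputable def P3val (p : Fin 3 → ℝ) (i : ℕ → Fin 3) : ℝ :=
  ∑' k : ℕ, P3beta p (i k) * ∏ r ∈ Finset.range k, p (i r)

/-- The digit permutation θ with θ(0)=0, θ(1)=2, θ(2)=1. -/
def P3theta : Fin 3 → Fin 3 := ![0, 2, 1]

/-- The one-sided shift on digit sequences. -/
def P3shift (i : ℕ → Fin 3) : ℕ → Fin 3 := fun k => i (k + 1)

/-- The left endpoint of the rank-`n` cylinder of a digit sequence. -/
noncomputable def P3partial (p : Fin 3 → ℝ) (i : ℕ → Fin 3) (n : ℕ) : ℝ :=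
  ∑ k ∈ Finset.range n, P3beta p (i k) * ∏ r ∈ Finset.range k, p (i r)

/-- A finite word, extended by zeros to a digit sequence. -/
def P3extend {n : ℕ} (w : Fin n → Fin 3) : ℕ → Fin 3 :=
  fun k => if h : k < n then w ⟨k, h⟩ else 0

/-- The rank-`n` cylinder of a digit sequence. -/
def P3cylinder (p : Fin 3 → ℝ) (i : ℕ → Fin 3) (n : ℕ) : Set ℝ :=
  Set.Icc (P3partial p i n) (P3partial p i n + ∏ r ∈ Finset.range n, p (i r))

/-- The step function equal to the product of the weights `c` along the word of each
rank-`n` cylinder. -/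
noncomputable def P3step (p c : Fin 3 → ℝ) (n : ℕ) (x : ℝ) : ENNReal :=
  ∑ w : Fin n → Fin 3, (P3cylinder p (P3extend w) n).indicator
    (fun _ => ENNReal.ofReal (∏ r ∈ Finset.range n, c (P3extend w r))) x

lemma P3beta_nonneg {p : Fin 3 → ℝ} (hp : ∀ t, 0 < p t) (t : Fin 3) : 0 ≤ P3beta p t := by
  have h0 := hp 0
  have h1 := hp 1
  fin_cases t <;> simp [P3beta] <;> linarith

lemma P3beta_add_le {p : Fin 3 → ℝ} (hp : ∀ t, 0 < p t) (hsum : p 0 + p 1 + p 2 = 1)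
    (t : Fin 3) : P3beta p t + p t ≤ 1 := by
  have h0 := hp 0
  have h1 := hp 1
  have h2 := hp 2
  fin_cases t <;> simp [P3beta] <;> linarith

lemma measurableSet_P3cylinder (p : Fin 3 → ℝ) (i : ℕ → Fin 3) (n : ℕ) :
    MeasurableSet (P3cylinder p i n) :=
  measurableSet_Icc

lemma P3val_mem_cylinder {p : Fin 3 → ℝ} (hp : ∀ t, 0 < p t) (hsum : p 0 + p 1 + p 2 = 1)
    (i : ℕ → Fin 3) (n : ℕ) : P3val p i ∈ P3cylinder p i n := by
  have hprod (k : ℕ) : 0 < ∏ r ∈ Finset.range k, p (i r) := Finset.prod_pos fun r _ => hp (i r)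
  have hterm (k : ℕ) : 0 ≤ P3beta p (i k) * ∏ r ∈ Finset.range k, p (i r) :=
    mul_nonneg (P3beta_nonneg hp _) (hprod k).le
  have hmono : Monotone (P3partial p i) := monotone_nat_of_le_succ fun k => by
    simpa [P3partial, Finset.sum_range_succ] using hterm k
  have hanti : Antitone fun k => P3partial p i k + ∏ r ∈ Finset.range k, p (i r) :=
    antitone_nat_of_succ_le fun k => by
      simp only [P3partial, Finset.sum_range_succ, Finset.prod_range_succ]
      nlinarith [mul_le_mul_of_nonneg_left (P3beta_add_le hp hsum (i k)) (hprod k).le]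
  have hle (m : ℕ) : P3partial p i m ≤ P3partial p i n + ∏ r ∈ Finset.range n, p (i r) := by
    rcases le_total m n with h | h
    · linarith [hmono h, hprod n]
    · have := hanti h
      simp only at this
      linarith [hprod m]
  exact ⟨(summable_of_sum_range_le hterm hle).sum_le_tsum _ fun k _ => hterm k,
    Real.tsum_le_of_sum_range_le hterm hle⟩

lemma P3extend_restrict {n r : ℕ} (i : ℕ → Fin 3) (hr : r < n) :
    P3extend (fun k : Fin n => i k) r = i r := by
  simp [P3extend, hr]

lemma P3cylinder_congr (p : Fin 3 → ℝ) {i j : ℕ → Fin 3} {n : ℕ} (h : ∀ r < n, i r = j r) :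
    P3cylinder p i n = P3cylinder p j n := by
  have hprod (k : ℕ) (hk : k ≤ n) :
      ∏ r ∈ Finset.range k, p (i r) = ∏ r ∈ Finset.range k, p (j r) :=
    Finset.prod_congr rfl fun r hr => by rw [h r ((Finset.mem_range.1 hr).trans_le hk)]
  have hpart : P3partial p i n = P3partial p j n := Finset.sum_congr rfl fun k hk => by
    rw [h k (Finset.mem_range.1 hk), hprod k (Finset.mem_range.1 hk).le]
  rw [P3cylinder, P3cylinder, hpart, hprod n le_rfl]

lemma ofReal_prod_le_P3step {p : Fin 3 → ℝ} (hp : ∀ t, 0 < p t) (hsum : p 0 + p 1 + p 2 = 1)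
    (c : Fin 3 → ℝ) (i : ℕ → Fin 3) (n : ℕ) :
    ENNReal.ofReal (∏ r ∈ Finset.range n, c (i r)) ≤ P3step p c n (P3val p i) := by
  let w : Fin n → Fin 3 := fun k => i k
  have hw : ∀ r < n, P3extend w r = i r := fun r hr => P3extend_restrict i hr
  have hmem : P3val p i ∈ P3cylinder p (P3extend w) n := by
    rw [P3cylinder_congr p hw]
    exact P3val_mem_cylinder hp hsum i n
  have hc : ∏ r ∈ Finset.range n, c (P3extend w r) = ∏ r ∈ Finset.range n, c (i r) :=
    Finset.prod_congr rfl fun r hr => by rw [hw r (Finset.mem_range.1 hr)]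
  refine le_trans ?_ (Finset.single_le_sum (fun _ _ => zero_le) (Finset.mem_univ w))
  rw [Set.indicator_of_mem hmem, hc]

lemma measurable_P3step (p c : Fin 3 → ℝ) (n : ℕ) : Measurable (P3step p c n) :=
  Finset.measurable_fun_sum _ fun _ _ => measurable_const.indicator (measurableSet_P3cylinder _ _ _)

lemma lintegral_P3step {p c : Fin 3 → ℝ} (hp : ∀ t, 0 < p t) (hc : ∀ t, 0 ≤ c t) (n : ℕ) :
    ∫⁻ x, P3step p c n x = ENNReal.ofReal (∑ t, c t * p t) ^ n := by
  have hcp (t : Fin 3) : 0 ≤ c t * p t := mul_nonneg (hc t) (hp t).le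
  have hword (w : Fin n → Fin 3) :
      ∫⁻ x, (P3cylinder p (P3extend w) n).indicator
        (fun _ => ENNReal.ofReal (∏ r ∈ Finset.range n, c (P3extend w r))) x =
      ENNReal.ofReal (∏ r, c (w r) * p (w r)) := by
    rw [lintegral_indicator_const (measurableSet_P3cylinder _ _ _), P3cylinder, Real.volume_Icc,
      add_sub_cancel_left, ← ENNReal.ofReal_mul (Finset.prod_nonneg fun _ _ => hc _),
      ← Finset.prod_mul_distrib, Finset.prod_range]
    simp [P3extend]
  simp only [P3step]
  rw [lintegral_finsetSum _ fun w _ => measurable_const.indicator (measurableSet_P3cylinder _ _ _)]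
  simp only [hword]
  rw [← ENNReal.ofReal_sum_of_nonneg fun w _ => Finset.prod_nonneg fun _ _ => hcp _,
    ← ENNReal.ofReal_pow (Finset.sum_nonneg fun t _ => hcp t), Fintype.sum_pow]

lemma sqrt_div_mul_self_eq {a b : ℝ} (hb : 0 < b) : √(a / b) * b = √a * √b := by
  rw [Real.sqrt_div' _ hb.le]
  have := Real.sqrt_pos.2 hb
  field_simp
  rw [Real.sq_sqrt hb.le]

/-- The Hellinger affinity of `p` and `p ∘ θ` is less than one. -/
lemma P3affinity_lt_one {p : Fin 3 → ℝ} (hp : ∀ t, 0 < p t) (hsum : p 0 + p 1 + p 2 = 1)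
    (h12 : p 1 ≠ p 2) : ∑ t, √(p (P3theta t) / p t) * p t < 1 := by
  simp only [sqrt_div_mul_self_eq (hp _), Fin.sum_univ_three]
  simp only [P3theta, Matrix.cons_val]
  have hne : √(p 1) - √(p 2) ≠ 0 :=
    sub_ne_zero.2 fun h => h12 ((Real.sqrt_inj (hp 1).le (hp 2).le).1 h)
  nlinarith [Real.mul_self_sqrt (hp 0).le, Real.mul_self_sqrt (hp 1).le,
    Real.mul_self_sqrt (hp 2).le, sq_pos_of_ne_zero hne]

theorem stmt17 (p : Fin 3 → ℝ) (hp : ∀ t, p t ∈ Set.Ioo (0 : ℝ) 1)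
    (hsum : p 0 + p 1 + p 2 = 1)
    (h12 : p 1 ≠ p 2) :
    ∀ᵐ x ∂(volume.restrict (Set.Icc (0 : ℝ) 1)),
      ∀ i : ℕ → Fin 3, P3val p i = x →
        Tendsto (fun k => ∏ r ∈ Finset.range k, p (P3theta (i r)) / p (i r))
          atTop (nhds 0) := by
  have hpos (t : Fin 3) : 0 < p t := (hp t).1
  let c : Fin 3 → ℝ := fun t => √(p (P3theta t) / p t)
  have hc (t : Fin 3) : 0 ≤ c t := Real.sqrt_nonneg _
  have hfin : ∫⁻ x, ∑' n, P3step p c n x ≠ ⊤ := by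
    rw [lintegral_tsum fun n => (measurable_P3step p c n).aemeasurable]
    simp only [lintegral_P3step hpos hc]
    rw [ENNReal.tsum_geometric]
    refine ENNReal.inv_ne_top.2 (tsub_pos_of_lt ?_).ne'
    rw [← ENNReal.ofReal_one]
    exact (ENNReal.ofReal_lt_ofReal_iff one_pos).2 (P3affinity_lt_one hpos hsum h12)
  refine ae_restrict_of_ae ?_
  filter_upwards [ae_lt_top (Measurable.tsum fun n => measurable_P3step p c n) hfin]
    with x hx i hi
  have hstep : Tendsto (fun n => P3step p c n x) atTop (nhds 0) :=
    ENNReal.tendsto_atTop_zero_of_tsum_ne_top hx.ne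
  have hroot : Tendsto (fun n => ∏ r ∈ Finset.range n, c (i r)) atTop (nhds 0) := by
    have hle := tendsto_of_tendsto_of_tendsto_of_le_of_le tendsto_const_nhds hstep
      (fun _ => zero_le) fun n => hi ▸ ofReal_prod_le_P3step hpos hsum c i n
    have := (ENNReal.tendsto_toReal ENNReal.zero_ne_top).comp hle
    refine this.congr fun n => ?_
    exact ENNReal.toReal_ofReal (Finset.prod_nonneg fun _ _ => hc _)
  have hsq := hroot.pow 2
  rw [zero_pow two_ne_zero] at hsq
  refine hsq.congr fun n => ?_
  rw [← Finset.prod_pow]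
  exact Finset.prod_congr rfl fun r _ => Real.sq_sqrt (div_pos (hpos _) (hpos _)).le
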